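/- arXiv:1401.2980 — 10 statements merged into one kernel-verified Lean document; each statement's English description precedes it below -/
import Mathlib

section
/- Let G be the subgroup of GL(5, ℝ) generated by: (i) the standard inversion matrix K, which is the identity matrix except that K₁₁ = K₂₂ = 0 and K₁₂ = K₂₁ = 1; (ii) the rescaling matrices diag(t, 1/t, 1, 1, 1) for every nonzero real t; (iii) for every (x,y,z) ∈ ℝ³, the translation matrix with rows (1,0,0,0,0), (x²+y²+z², 1, x, y, z), (2x,0,1,0,0), (2y,0,0,1,0), (2z,0,0,0,1); and (iv) the block matrices with upper-left 2×2 block the identity and lower-right 3×3 block R, for every R in SO(3). Then every matrix M in G satisfies M·Q_Σ·Mᵀ = Q_Σ. -/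
open Matrix

noncomputable section

/-- The inversive product matrix `Q_Σ`. -/
def Qsigma : Matrix (Fin 5) (Fin 5) ℝ :=
  !![0, -(1/2), 0, 0, 0;
     -(1/2), 0, 0, 0, 0;
     0, 0, 1, 0, 0;
     0, 0, 0, 1, 0;
     0, 0, 0, 0, 1]

/-- The standard inversion matrix `K`. -/
def stdInversion : Matrix (Fin 5) (Fin 5) ℝ :=
  !![0, 1, 0, 0, 0;
     1, 0, 0, 0, 0;
     0, 0, 1, 0, 0;
     0, 0, 0, 1, 0;
     0, 0, 0, 0, 1]

/-- The rescaling matrix `diag(t, 1/t, 1, 1, 1)`. -/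
def rescaleMat (t : ℝ) : Matrix (Fin 5) (Fin 5) ℝ :=
  !![t, 0, 0, 0, 0;
     0, t⁻¹, 0, 0, 0;
     0, 0, 1, 0, 0;
     0, 0, 0, 1, 0;
     0, 0, 0, 0, 1]

/-- The translation matrix for `(x, y, z)`. -/
def translMat (x y z : ℝ) : Matrix (Fin 5) (Fin 5) ℝ :=
  !![1, 0, 0, 0, 0;
     x^2 + y^2 + z^2, 1, x, y, z;
     2*x, 0, 1, 0, 0;
     2*y, 0, 0, 1, 0;
     2*z, 0, 0, 0, 1]

/-- The block matrix with upper-left `2 × 2` identity block and lower-right `3 × 3` block `R`. -/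
def rotMat (R : Matrix (Fin 3) (Fin 3) ℝ) : Matrix (Fin 5) (Fin 5) ℝ :=
  !![1, 0, 0, 0, 0;
     0, 1, 0, 0, 0;
     0, 0, R 0 0, R 0 1, R 0 2;
     0, 0, R 1 0, R 1 1, R 1 2;
     0, 0, R 2 0, R 2 1, R 2 2]

/-- The generators of the (matrix) Möbius group. -/
def mobiusGens : Set (GL (Fin 5) ℝ) :=
  { M | (M : Matrix (Fin 5) (Fin 5) ℝ) = stdInversion ∨
        (∃ t : ℝ, t ≠ 0 ∧ (M : Matrix (Fin 5) (Fin 5) ℝ) = rescaleMat t) ∨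
        (∃ x y z : ℝ, (M : Matrix (Fin 5) (Fin 5) ℝ) = translMat x y z) ∨
        (∃ R : Matrix (Fin 3) (Fin 3) ℝ, R * Rᵀ = 1 ∧ R.det = 1 ∧
          (M : Matrix (Fin 5) (Fin 5) ℝ) = rotMat R) }

theorem stdInversion_preserves_Qsigma :
    stdInversion * Qsigma * stdInversionᵀ = Qsigma := by
  ext i j
  fin_cases i <;> fin_cases j <;>
    simp [stdInversion, Qsigma, Matrix.mul_apply, Fin.sum_univ_five]

theorem rescaleMat_preserves_Qsigma {t : ℝ} (ht : t ≠ 0) :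
    rescaleMat t * Qsigma * (rescaleMat t)ᵀ = Qsigma := by
  ext i j
  fin_cases i <;> fin_cases j <;>
    simp [rescaleMat, Qsigma, Matrix.mul_apply, Fin.sum_univ_five] <;> field_simp

theorem translMat_preserves_Qsigma (x y z : ℝ) :
    translMat x y z * Qsigma * (translMat x y z)ᵀ = Qsigma := by
  ext i j
  fin_cases i <;> fin_cases j <;>
    simp [translMat, Qsigma, Matrix.mul_apply, Fin.sum_univ_five] <;> ring

theorem rotMat_preserves_Qsigma {R : Matrix (Fin 3) (Fin 3) ℝ} (hR : R * Rᵀ = 1) :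
    rotMat R * Qsigma * (rotMat R)ᵀ = Qsigma := by
  have h (i j : Fin 3) :
      R i 0 * R j 0 + R i 1 * R j 1 + R i 2 * R j 2 = (1 : Matrix (Fin 3) (Fin 3) ℝ) i j := by
    rw [← hR]
    simp [Matrix.mul_apply, Fin.sum_univ_three]
  ext i j
  fin_cases i <;> fin_cases j <;>
    simp [rotMat, Qsigma, Matrix.mul_apply, Fin.sum_univ_five, h]

/-- Every element of the Möbius group preserves the inversive product matrix `Q_Σ`. -/
theorem mobius_preserves_inversive_product
    (M : GL (Fin 5) ℝ) (hM : M ∈ Subgroup.closure mobiusGens) :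
    (M : Matrix (Fin 5) (Fin 5) ℝ) * Qsigma * (M : Matrix (Fin 5) (Fin 5) ℝ)ᵀ = Qsigma := by
  induction hM using Subgroup.closure_induction with
  | mem M hM =>
    rcases hM with h | ⟨t, ht, h⟩ | ⟨x, y, z, h⟩ | ⟨R, hR, -, h⟩ <;> rw [h]
    · exact stdInversion_preserves_Qsigma
    · exact rescaleMat_preserves_Qsigma ht
    · exact translMat_preserves_Qsigma x y z
    · exact rotMat_preserves_Qsigma hR
  | one => simp
  | mul A B _ _ hA hB =>
    calc ((A * B : GL (Fin 5) ℝ) : Matrix (Fin 5) (Fin 5) ℝ) * Qsigma *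
          ((A * B : GL (Fin 5) ℝ) : Matrix (Fin 5) (Fin 5) ℝ)ᵀ
        = (A : Matrix (Fin 5) (Fin 5) ℝ) *
            ((B : Matrix (Fin 5) (Fin 5) ℝ) * Qsigma * (B : Matrix (Fin 5) (Fin 5) ℝ)ᵀ) *
            (A : Matrix (Fin 5) (Fin 5) ℝ)ᵀ := by
          simp only [Units.val_mul, Matrix.transpose_mul, Matrix.mul_assoc]
      _ = Qsigma := by rw [hB, hA]
  | inv A _ hA =>
    have hl : ((A⁻¹ : GL (Fin 5) ℝ) : Matrix (Fin 5) (Fin 5) ℝ) * A = 1 := A.inv_mul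
    have hr : (A : Matrix (Fin 5) (Fin 5) ℝ)ᵀ *
        ((A⁻¹ : GL (Fin 5) ℝ) : Matrix (Fin 5) (Fin 5) ℝ)ᵀ = 1 := by
      rw [← Matrix.transpose_mul, hl, Matrix.transpose_one]
    conv_lhs => rw [← hA]
    simp only [Matrix.mul_assoc, hr, Matrix.mul_one]
    rw [← Matrix.mul_assoc, hl, Matrix.one_mul]

end
end

section
/- (Orthoplicial Descartes–Guettler–Mallows Theorem, matrix form) Let M be a 5×5 real matrix satisfying M·Q_Σ·Mᵀ = Q_Σ, and set F = F₀·M. Then Fᵀ·Q_F·F = Q_W. In particular, each of the five column vectors c of F satisfies cᵀ·Q_F·c equal to the corresponding diagonal entry of Q_W: the first two columns a, b satisfy aᵀQ_F a = 0 and bᵀQ_F b = 0, and each of the last three columns x̂, ŷ, ẑ satisfies x̂ᵀQ_F x̂ = 2, ŷᵀQ_F ŷ = 2, ẑᵀQ_F ẑ = 2. -/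
open Matrix

noncomputable section

/-- The `F`-matrix of the standard orthoplicial Platonic configuration. -/
def F0 : Matrix (Fin 5) (Fin 5) ℝ :=
  !![2, 0, 0, 0, 1;
     2, 0, 0, 0, -1;
     1, 1, Real.sqrt 2, 0, 0;
     1, 1, 0, Real.sqrt 2, 0;
     1, 1, 0, 0, 0]

/-- The matrix `Q_F` of the orthoplicial Descartes form. -/
def QF : Matrix (Fin 5) (Fin 5) ℝ :=
  !![1, 0, 0, 0, -1;
     0, 1, 0, 0, -1;
     0, 0, 1, 0, -1;
     0, 0, 0, 1, -1;
     -1, -1, -1, -1, 2]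

/-- The Wilker matrix `Q_W`. -/
def QW : Matrix (Fin 5) (Fin 5) ℝ :=
  !![0, -4, 0, 0, 0;
     -4, 0, 0, 0, 0;
     0, 0, 2, 0, 0;
     0, 0, 0, 2, 0;
     0, 0, 0, 0, 2]

/-- The value of the orthoplicial Descartes form on the `j`-th column of `F`. -/
def colQuad (F : Matrix (Fin 5) (Fin 5) ℝ) (j : Fin 5) : ℝ :=
  (fun i => F i j) ⬝ᵥ (QF *ᵥ fun i => F i j)

/-- A matrix preserving a bilinear form contravariantly preserves the inverse form covariantly. -/
theorem transpose_mul_mul_eq_of_mul_eq_one {n R : Type*} [Fintype n] [DecidableEq n] [CommRing R]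
    {M Q W : Matrix n n R} (hQW : Q * W = 1) (hM : M * Q * Mᵀ = Q) : Mᵀ * W * M = W := by
  have hWQ : W * Q = 1 := mul_eq_one_comm.mp hQW
  have hright : M * (Q * Mᵀ * W) = 1 := by
    rw [← hQW]
    nth_rewrite 2 [← hM]
    simp only [Matrix.mul_assoc]
  have hleft : Q * Mᵀ * W * M = 1 := mul_eq_one_comm.mp hright
  calc Mᵀ * W * M = W * Q * (Mᵀ * W * M) := by rw [hWQ, Matrix.one_mul]
    _ = W * (Q * Mᵀ * W * M) := by simp only [Matrix.mul_assoc]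
    _ = W := by rw [hleft, Matrix.mul_one]

theorem Qsigma_mul_half_QW : Qsigma * ((1 / 2 : ℝ) • QW) = 1 := by
  ext i j
  fin_cases i <;> fin_cases j <;>
    simp [Qsigma, QW, Matrix.mul_apply, Fin.sum_univ_succ] <;> norm_num

theorem F0_transpose_mul_QF_mul_F0 : F0ᵀ * QF * F0 = QW := by
  ext i j
  fin_cases i <;> fin_cases j <;>
    simp [F0, QF, QW, Matrix.mul_apply, Fin.sum_univ_succ] <;> norm_num

theorem colQuad_eq_diag (F : Matrix (Fin 5) (Fin 5) ℝ) (j : Fin 5) :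
    colQuad F j = (Fᵀ * QF * F) j j := by
  rw [Matrix.mul_assoc]
  rfl

/-- Orthoplicial Descartes–Guettler–Mallows theorem, matrix form: `Fᵀ Q_F F = Q_W`; in
particular the bend columns are null vectors of `Q_F` and the coordinate columns have value 2. -/
theorem orthoplicial_descartes_guettler_mallows
    (M : Matrix (Fin 5) (Fin 5) ℝ) (hM : M * Qsigma * Mᵀ = Qsigma) :
    (F0 * M)ᵀ * QF * (F0 * M) = QW ∧
    (∀ j : Fin 5, colQuad (F0 * M) j = QW j j) ∧
    colQuad (F0 * M) 0 = 0 ∧ colQuad (F0 * M) 1 = 0 ∧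
    colQuad (F0 * M) 2 = 2 ∧ colQuad (F0 * M) 3 = 2 ∧ colQuad (F0 * M) 4 = 2 := by
  have hW : Mᵀ * QW * M = QW := by
    have h := transpose_mul_mul_eq_of_mul_eq_one Qsigma_mul_half_QW hM
    rw [Matrix.mul_smul, Matrix.smul_mul] at h
    exact smul_right_injective _ (by norm_num : (1 / 2 : ℝ) ≠ 0) h
  have hF : (F0 * M)ᵀ * QF * (F0 * M) = QW := by
    rw [← hW, ← F0_transpose_mul_QF_mul_F0, Matrix.transpose_mul]
    simp only [Matrix.mul_assoc]
  have hcol (j : Fin 5) : colQuad (F0 * M) j = QW j j := by rw [colQuad_eq_diag, hF]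
  exact ⟨hF, hcol, hcol 0, hcol 1, hcol 2, hcol 3, hcol 4⟩

end
end

section
/- (Bend relations for orthoplicial configurations) Let M be a 5×5 real matrix satisfying M·Q_Σ·Mᵀ = Q_Σ, set V = V₀·M (an 8×5 real matrix), and let b₁,...,b₈ denote the entries of the second column of V. Then b₁+b₅ = b₂+b₆ = b₃+b₇ = b₄+b₈, and (b₁+b₅)² − 2(b₁+b₅)(b₁+b₂+b₃+b₄) + 2(b₁²+b₂²+b₃²+b₄²) = 0. -/
open Matrix

noncomputable section

/-- The `V`-matrix of the standard orthoplicial Platonic configuration. -/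
def V0 : Matrix (Fin 8) (Fin 5) ℝ :=
  !![2, 0, 0, 0, 1;
     2, 0, 0, 0, -1;
     1, 1, Real.sqrt 2, 0, 0;
     1, 1, 0, Real.sqrt 2, 0;
     0, 2, 0, 0, -1;
     0, 2, 0, 0, 1;
     1, 1, -Real.sqrt 2, 0, 0;
     1, 1, 0, -Real.sqrt 2, 0]

/-- If `M` preserves the form `Qsigma`, each column `v` of `M` satisfies
`v ⬝ Q⁻¹ v = Q⁻¹ j j`; for the second column the right-hand side vanishes. -/
theorem second_column_isotropic
    (M : Matrix (Fin 5) (Fin 5) ℝ) (hM : M * Qsigma * Mᵀ = Qsigma) :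
    (M 2 1)^2 + (M 3 1)^2 + (M 4 1)^2 = 4 * M 0 1 * M 1 1 := by
  let R : Matrix (Fin 5) (Fin 5) ℝ :=
    !![0, -2, 0, 0, 0;
       -2, 0, 0, 0, 0;
       0, 0, 1, 0, 0;
       0, 0, 0, 1, 0;
       0, 0, 0, 0, 1]
  have hQR : Qsigma * R = 1 := by
    ext i j
    fin_cases i <;> fin_cases j <;>
      simp [Qsigma, R, Matrix.mul_apply, Fin.sum_univ_five]
  have hRQ : R * Qsigma = 1 := mul_eq_one_comm.mp hQR
  have hinv : M * (Qsigma * Mᵀ * R) = 1 := by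
    rw [← mul_assoc, ← mul_assoc, hM, hQR]
  have hdual : Mᵀ * R * M = R := calc
    Mᵀ * R * M = R * (Qsigma * Mᵀ * R * M) := by
      simp only [← mul_assoc, hRQ, one_mul]
    _ = R := by rw [mul_eq_one_comm.mp hinv, mul_one]
  have h := congrFun (congrFun hdual 1) 1
  simp [R, Matrix.mul_apply, Fin.sum_univ_five] at h
  linarith

/-- Bend relations for orthoplicial configurations: antipodal bends have a common sum `2b_μ`,
and the bends satisfy the orthoplicial Descartes–Guettler–Mallows equation. -/
theorem orthoplicial_bend_relations
    (M : Matrix (Fin 5) (Fin 5) ℝ) (hM : M * Qsigma * Mᵀ = Qsigma)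
    (b : Fin 8 → ℝ) (hb : ∀ k, b k = (V0 * M) k 1) :
    (b 0 + b 4 = b 1 + b 5 ∧ b 1 + b 5 = b 2 + b 6 ∧ b 2 + b 6 = b 3 + b 7) ∧
    (b 0 + b 4)^2 - 2*(b 0 + b 4)*(b 0 + b 1 + b 2 + b 3)
      + 2*((b 0)^2 + (b 1)^2 + (b 2)^2 + (b 3)^2) = 0 := by
  have hcol := second_column_isotropic M hM
  have hsqrt : Real.sqrt 2 ^ 2 = 2 := Real.sq_sqrt (by norm_num)
  have h0 : b 0 = 2 * M 0 1 + M 4 1 := by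
    simp [hb, V0, Matrix.mul_apply, Fin.sum_univ_five]
  have h1 : b 1 = 2 * M 0 1 - M 4 1 := by
    simp [hb, V0, Matrix.mul_apply, Fin.sum_univ_five]; ring
  have h2 : b 2 = M 0 1 + M 1 1 + Real.sqrt 2 * M 2 1 := by
    simp [hb, V0, Matrix.mul_apply, Fin.sum_univ_five]
  have h3 : b 3 = M 0 1 + M 1 1 + Real.sqrt 2 * M 3 1 := by
    simp [hb, V0, Matrix.mul_apply, Fin.sum_univ_five]
  have h4 : b 4 = 2 * M 1 1 - M 4 1 := by
    simp [hb, V0, Matrix.mul_apply, Fin.sum_univ_five]; ring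
  have h5 : b 5 = 2 * M 1 1 + M 4 1 := by
    simp [hb, V0, Matrix.mul_apply, Fin.sum_univ_five]
  have h6 : b 6 = M 0 1 + M 1 1 - Real.sqrt 2 * M 2 1 := by
    simp [hb, V0, Matrix.mul_apply, Fin.sum_univ_five]; ring
  have h7 : b 7 = M 0 1 + M 1 1 - Real.sqrt 2 * M 3 1 := by
    simp [hb, V0, Matrix.mul_apply, Fin.sum_univ_five]; ring
  rw [h0, h1, h2, h3, h4, h5, h6, h7]
  refine ⟨⟨by ring, by ring, by ring⟩, ?_⟩
  linear_combination 4 * hcol + 2 * ((M 2 1)^2 + (M 3 1)^2) * hsqrt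

end
end

section
/- (Integrality of the antipodal bend) Let b₁, b₂, b₃, b₄, m be integers satisfying m² − 2m(b₁+b₂+b₃+b₄) + 2(b₁²+b₂²+b₃²+b₄²) = 0. Then m is even. (Equivalently: if a real number b_μ satisfies the orthoplicial Descartes equation 2b_μ² − 2b_μ(b₁+b₂+b₃+b₄) + (b₁²+b₂²+b₃²+b₄²) = 0 with b₁,...,b₄ ∈ ℤ and 2b_μ ∈ ℤ, then b_μ ∈ ℤ.) -/
/-- Integrality of the antipodal bend: if integers `b₁, b₂, b₃, b₄, m` satisfy
`m² − 2m(b₁+b₂+b₃+b₄) + 2(b₁²+b₂²+b₃²+b₄²) = 0`, then `m` is even. -/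
theorem antipodal_bend_even (b1 b2 b3 b4 m : ℤ)
    (h : m^2 - 2*m*(b1 + b2 + b3 + b4) + 2*(b1^2 + b2^2 + b3^2 + b4^2) = 0) :
    Even m := by
  have hm : Even (m ^ 2) :=
    even_iff_two_dvd.mpr
      ⟨m * (b1 + b2 + b3 + b4) - (b1 ^ 2 + b2 ^ 2 + b3 ^ 2 + b4 ^ 2), by linarith⟩
  exact (Int.even_pow.mp hm).1
end

section
/- (Primitivity criterion) Let b₁, b₂, b₃, b₄, b_μ be integers satisfying 2b_μ² − 2b_μ(b₁+b₂+b₃+b₄) + (b₁²+b₂²+b₃²+b₄²) = 0, and set b_{k+4} = 2b_μ − b_k for k = 1,2,3,4. Then gcd(b₁, b₂, b₃, b₄, b_μ) = 1 if and only if gcd(b₁, b₂, b₃, b₄, b₅, b₆, b₇, b₈) = 1. -/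
/-- A prime dividing the four bends and twice the last entry of an integral zero of the
orthoplicial Descartes form divides that last entry. -/
theorem Nat.Prime.dvd_of_orthoplicialForm_eq_zero {p : ℕ} (hp : p.Prime) {a b c d m : ℤ}
    (hD : 2*m^2 - 2*m*(a + b + c + d) + (a^2 + b^2 + c^2 + d^2) = 0)
    (ha : (p : ℤ) ∣ a) (hb : (p : ℤ) ∣ b) (hc : (p : ℤ) ∣ c) (hd : (p : ℤ) ∣ d)
    (hm : (p : ℤ) ∣ 2 * m) : (p : ℤ) ∣ m := by
  rcases (Nat.prime_iff_prime_int.mp hp).dvd_or_dvd hm with h | h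
  · have hp2 : p = 2 := (Nat.prime_dvd_prime_iff_eq hp Nat.prime_two).mp (by exact_mod_cast h)
    subst hp2
    obtain ⟨a, rfl⟩ := ha
    obtain ⟨b, rfl⟩ := hb
    obtain ⟨c, rfl⟩ := hc
    obtain ⟨d, rfl⟩ := hd
    refine Int.prime_two.dvd_of_dvd_pow (n := 2)
      ⟨m * (a + b + c + d) - (a^2 + b^2 + c^2 + d^2), ?_⟩
    push_cast at hD
    linarith
  · exact h


/-- Primitivity criterion: for a bend vector `(b₁,b₂,b₃,b₄,b_μ)` of an orthoplicial
configuration, with complementary bends `b_{k+4} = 2b_μ − b_k`, the five-entry gcd is 1 if and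
only if the eight-entry gcd is 1. -/
theorem primitivity_criterion (b1 b2 b3 b4 bmu b5 b6 b7 b8 : ℤ)
    (hD : 2*bmu^2 - 2*bmu*(b1 + b2 + b3 + b4) + (b1^2 + b2^2 + b3^2 + b4^2) = 0)
    (h5 : b5 = 2*bmu - b1) (h6 : b6 = 2*bmu - b2) (h7 : b7 = 2*bmu - b3)
    (h8 : b8 = 2*bmu - b4) :
    Int.gcd b1 (Int.gcd b2 (Int.gcd b3 (Int.gcd b4 bmu))) = 1 ↔
    Int.gcd b1 (Int.gcd b2 (Int.gcd b3 (Int.gcd b4 (Int.gcd b5 (Int.gcd b6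
      (Int.gcd b7 b8)))))) = 1 := by
  simp only [Nat.eq_one_iff_not_exists_prime_dvd, ← Int.natCast_dvd_natCast, Int.dvd_coe_gcd_iff]
  refine forall₂_congr fun p hp => not_congr ⟨?_, ?_⟩
  · rintro ⟨h1, h2, h3, h4, hm⟩
    subst h5 h6 h7 h8
    have hm2 := hm.mul_left 2
    exact ⟨h1, h2, h3, h4, hm2.sub h1, hm2.sub h2, hm2.sub h3, hm2.sub h4⟩
  · rintro ⟨h1, h2, h3, h4, hq, -⟩
    refine ⟨h1, h2, h3, h4, hp.dvd_of_orthoplicialForm_eq_zero hD h1 h2 h3 h4 ?_⟩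
    simpa [h5] using hq.add h1
end

section
/- (Uniqueness of the two adjacent configurations) Let F be a 5×5 real matrix whose first four rows are (2,0,0,0,1), (2,0,0,0,−1), (1,1,√2,0,0), (1,1,0,√2,0), and which satisfies Fᵀ·Q_F·F = Q_W. Then F = F₀ or F = F₀′. -/
open Matrix

noncomputable section

/-- The `F`-matrix of the configuration adjacent to the standard one along its first four
spheres. -/
def F0' : Matrix (Fin 5) (Fin 5) ℝ :=
  !![2, 0, 0, 0, 1;
     2, 0, 0, 0, -1;
     1, 1, Real.sqrt 2, 0, 0;
     1, 1, 0, Real.sqrt 2, 0;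
     5, 1, Real.sqrt 2, Real.sqrt 2, 0]

/-- Uniqueness of the two adjacent configurations: any `F`-matrix with the standard first four
rows satisfying `Fᵀ Q_F F = Q_W` is `F₀` or `F₀′`. -/
theorem adjacent_configurations_unique
    (F : Matrix (Fin 5) (Fin 5) ℝ)
    (h0 : F 0 = ![2, 0, 0, 0, 1])
    (h1 : F 1 = ![2, 0, 0, 0, -1])
    (h2 : F 2 = ![1, 1, Real.sqrt 2, 0, 0])
    (h3 : F 3 = ![1, 1, 0, Real.sqrt 2, 0])
    (hF : Fᵀ * QF * F = QW) :
    F = F0 ∨ F = F0' := by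
  have h (i j : Fin 5) := congrFun (congrFun hF i) j
  have e00 := h 0 0
  have e11 := h 1 1
  have e44 := h 4 4
  have e02 := h 0 2
  have e03 := h 0 3
  simp [Matrix.mul_apply, Fin.sum_univ_five, QF, QW, h0, h1, h2, h3] at e00 e11 e44 e02 e03
  have hb : F 4 1 = 1 := by
    have : (F 4 1 - 1) ^ 2 = 0 := by linarith
    linarith [pow_eq_zero_iff two_ne_zero |>.mp this]
  have he : F 4 4 = 0 := by
    have : F 4 4 ^ 2 = 0 := by linarith
    exact pow_eq_zero_iff two_ne_zero |>.mp this
  have ha : (F 4 0 - 1) * (F 4 0 - 5) = 0 := by linarith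
  rcases mul_eq_zero.mp ha with ha | ha
  · left
    have ha : F 4 0 = 1 := by linarith
    rw [ha] at e02 e03
    have hc : F 4 2 = 0 := by linarith
    have hd : F 4 3 = 0 := by linarith
    ext i j
    fin_cases i <;> fin_cases j <;> simp [F0, h0, h1, h2, h3, ha, hb, hc, hd, he]
  · right
    have ha : F 4 0 = 5 := by linarith
    rw [ha] at e02 e03
    have hc : F 4 2 = Real.sqrt 2 := by linarith
    have hd : F 4 3 = Real.sqrt 2 := by linarith
    ext i j
    fin_cases i <;> fin_cases j <;> simp [F0', h0, h1, h2, h3, ha, hb, hc, hd, he]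

end
end

section
/- (Local obstruction modulo 4) Let b₁, b₂, b₃, b₄, b_μ be integers with gcd(b₁,b₂,b₃,b₄,b_μ) = 1 satisfying 2b_μ² − 2b_μ(b₁+b₂+b₃+b₄) + (b₁²+b₂²+b₃²+b₄²) = 0, and set b_{k+4} = 2b_μ − b_k for k = 1,2,3,4. Then there exist ε ∈ ℤ/4ℤ with ε = 1 or ε = 3, and a permutation σ of {1,2,3,4}, such that modulo 4: the unordered pair (b_{σ(1)}, b_{σ(1)+4}) is (0,2) or (2,0), the unordered pair (b_{σ(2)}, b_{σ(2)+4}) is (0,2) or (2,0), and b_{σ(3)} ≡ b_{σ(3)+4} ≡ b_{σ(4)} ≡ b_{σ(4)+4} ≡ ε (mod 4). In particular, none of the eight bends b₁,...,b₈ is congruent to −ε modulo 4. -/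
theorem Int.sq_emod_four_eq_emod_two (b : ℤ) : b ^ 2 % 4 = b % 2 := by
  rcases Int.even_or_odd' b with ⟨c, rfl | rfl⟩ <;> ring_nf <;> omega

theorem exists_perm_of_two_true (p : Fin 4 → Bool)
    (hp : (p 0).toNat + (p 1).toNat + (p 2).toNat + (p 3).toNat = 2) :
    ∃ σ : Equiv.Perm (Fin 4),
      p (σ 0) = false ∧ p (σ 1) = false ∧ p (σ 2) = true ∧ p (σ 3) = true := by
  revert p
  decide

theorem exists_perm_even_even_odd_odd (B : Fin 4 → ℤ)
    (hB : B 0 % 2 + B 1 % 2 + B 2 % 2 + B 3 % 2 = 2) :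
    ∃ σ : Equiv.Perm (Fin 4),
      Even (B (σ 0)) ∧ Even (B (σ 1)) ∧ Odd (B (σ 2)) ∧ Odd (B (σ 3)) := by
  have toNat_decide (k : Fin 4) : ((decide (Odd (B k))).toNat : ℤ) = B k % 2 := by
    rcases Int.even_or_odd (B k) with h | h
    · simp [h, Int.even_iff.mp h]
    · simp [h, Int.odd_iff.mp h]
  obtain ⟨σ, h⟩ := exists_perm_of_two_true (fun k => decide (Odd (B k))) (by
    zify
    simpa only [toNat_decide] using hB)
  exact ⟨σ, by simpa using h⟩

theorem even_bends_of_even_bmu (B : Fin 4 → ℤ) (m : ℤ)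
    (hD : 2 * m ^ 2 - 2 * m * ∑ k, B k + ∑ k, B k ^ 2 = 0) (hm : Even m) (k : Fin 4) :
    Even (B k) := by
  obtain ⟨n, rfl⟩ := hm.two_dvd
  simp only [Fin.sum_univ_four] at hD
  have sq (j : Fin 4) := Int.sq_emod_four_eq_emod_two (B j)
  have parity : B 0 % 2 + B 1 % 2 + B 2 % 2 + B 3 % 2 = 0 ∨
      B 0 % 2 + B 1 % 2 + B 2 % 2 + B 3 % 2 = 4 := by
    have h : 4 * (2 * n ^ 2 - n * (B 0 + B 1 + B 2 + B 3)) +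
        (B 0 ^ 2 + B 1 ^ 2 + B 2 ^ 2 + B 3 ^ 2) = 0 := by linear_combination hD
    have := sq 0; have := sq 1; have := sq 2; have := sq 3
    omega
  rcases parity with h | h
  · rw [Int.even_iff]
    fin_cases k <;> simp <;> omega
  · exfalso
    have odd_sq (j : Fin 4) (hj : B j % 2 = 1) : B j ^ 2 % 8 = 1 := by
      have := Int.eight_dvd_sq_sub_one_of_odd (Int.odd_iff.mpr hj)
      omega
    have := odd_sq 0 (by omega); have := odd_sq 1 (by omega)
    have := odd_sq 2 (by omega); have := odd_sq 3 (by omega)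
    obtain ⟨s, hs⟩ : ∃ s, B 0 + B 1 + B 2 + B 3 = 2 * s :=
      ⟨(B 0 + B 1 + B 2 + B 3) / 2, by omega⟩
    have h8 : 8 * (n ^ 2 - n * s) + (B 0 ^ 2 + B 1 ^ 2 + B 2 ^ 2 + B 3 ^ 2) = 0 := by
      linear_combination hD + 4 * n * hs
    omega

theorem sum_emod_two_of_odd_bmu (B : Fin 4 → ℤ) (m : ℤ)
    (hD : 2 * m ^ 2 - 2 * m * ∑ k, B k + ∑ k, B k ^ 2 = 0) (hm : Odd m) :
    B 0 % 2 + B 1 % 2 + B 2 % 2 + B 3 % 2 = 2 := by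
  obtain ⟨n, rfl⟩ := hm
  simp only [Fin.sum_univ_four] at hD
  have sq (j : Fin 4) := Int.sq_emod_four_eq_emod_two (B j)
  have h : 4 * (2 * n ^ 2 + 2 * n - n * (B 0 + B 1 + B 2 + B 3)) + 2
      - 2 * (B 0 + B 1 + B 2 + B 3) + (B 0 ^ 2 + B 1 ^ 2 + B 2 ^ 2 + B 3 ^ 2) = 0 := by
    linear_combination hD
  have := sq 0; have := sq 1; have := sq 2; have := sq 3
  omega

theorem odd_bends_congr_mod_four (a b c d m : ℤ)
    (hD : 2 * m ^ 2 - 2 * m * (a + b + c + d) + (a ^ 2 + b ^ 2 + c ^ 2 + d ^ 2) = 0)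
    (hm : Odd m) (ha : Even a) (hb : Even b) (hc : Odd c) (hd : Odd d) : c % 4 = d % 4 := by
  obtain ⟨n, rfl⟩ := hm
  obtain ⟨a, rfl⟩ := ha.two_dvd
  obtain ⟨b, rfl⟩ := hb.two_dvd
  obtain ⟨c, rfl⟩ := hc
  obtain ⟨d, rfl⟩ := hd
  have h : (a - n) * (a - n - 1) + (b - n) * (b - n - 1) + (c - n) ^ 2 + (d - n) ^ 2
      = 2 * (n * (n + 1)) := by linarith
  have hcd : Even (c + d) := by
    have := congrArg Even h
    simp [parity_simps] at this
    grind
  obtain ⟨s, hs⟩ := hcd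
  omega

theorem even_bend_pair_mod_four {b m : ℤ} (hm : Odd m) (hb : Even b) :
    ((b : ZMod 4) = 0 ∧ ((2 * m - b : ℤ) : ZMod 4) = 2) ∨
      ((b : ZMod 4) = 2 ∧ ((2 * m - b : ℤ) : ZMod 4) = 0) := by
  obtain ⟨n, rfl⟩ := hm
  obtain ⟨c, rfl⟩ := hb.two_dvd
  push_cast
  generalize (n : ZMod 4) = n, (c : ZMod 4) = c
  decide +revert

theorem odd_bend_pair_mod_four {b m : ℤ} (hm : Odd m) (hb : Odd b) :
    ((b : ZMod 4) = 1 ∨ (b : ZMod 4) = 3) ∧ ((2 * m - b : ℤ) : ZMod 4) = b := by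
  obtain ⟨n, rfl⟩ := hm
  obtain ⟨c, rfl⟩ := hb
  push_cast
  generalize (n : ZMod 4) = n, (c : ZMod 4) = c
  decide +revert


/-- Local obstruction modulo 4 for primitive orthoplicial bend vectors: up to a permutation of
the four antipodal pairs, two pairs are `(0,2)` mod 4 (in some order within each pair) and two
pairs are `(ε,ε)` mod 4 for some `ε ∈ {1,3}`; in particular no bend is `≡ −ε (mod 4)`. -/
theorem local_obstruction_mod_four (b1 b2 b3 b4 bmu : ℤ)
    (hgcd : Int.gcd b1 (Int.gcd b2 (Int.gcd b3 (Int.gcd b4 bmu))) = 1)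
    (hD : 2*bmu^2 - 2*bmu*(b1 + b2 + b3 + b4) + (b1^2 + b2^2 + b3^2 + b4^2) = 0)
    (B B' : Fin 4 → ℤ) (hB : B = ![b1, b2, b3, b4]) (hB' : ∀ k, B' k = 2*bmu - B k) :
    ∃ ε : ZMod 4, (ε = 1 ∨ ε = 3) ∧
      (∃ σ : Equiv.Perm (Fin 4),
        (((B (σ 0) : ZMod 4) = 0 ∧ (B' (σ 0) : ZMod 4) = 2) ∨
          ((B (σ 0) : ZMod 4) = 2 ∧ (B' (σ 0) : ZMod 4) = 0)) ∧
        (((B (σ 1) : ZMod 4) = 0 ∧ (B' (σ 1) : ZMod 4) = 2) ∨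
          ((B (σ 1) : ZMod 4) = 2 ∧ (B' (σ 1) : ZMod 4) = 0)) ∧
        (B (σ 2) : ZMod 4) = ε ∧ (B' (σ 2) : ZMod 4) = ε ∧
        (B (σ 3) : ZMod 4) = ε ∧ (B' (σ 3) : ZMod 4) = ε) ∧
      (∀ k : Fin 4, (B k : ZMod 4) ≠ -ε ∧ (B' k : ZMod 4) ≠ -ε) := by
  have hsum : 2 * bmu ^ 2 - 2 * bmu * ∑ k, B k + ∑ k, B k ^ 2 = 0 := by
    simpa [hB, Fin.sum_univ_four] using hD
  have hm : Odd bmu := by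
    by_contra hm
    rw [Int.not_odd_iff_even] at hm
    have even_bend := even_bends_of_even_bmu B bmu hsum hm
    simp only [hB] at even_bend
    have h2 : ((2 : ℕ) : ℤ) ∣ Int.gcd b1 (Int.gcd b2 (Int.gcd b3 (Int.gcd b4 bmu))) :=
      Int.dvd_coe_gcd (even_bend 0).two_dvd <| Int.dvd_coe_gcd (even_bend 1).two_dvd <|
        Int.dvd_coe_gcd (even_bend 2).two_dvd <| Int.dvd_coe_gcd (even_bend 3).two_dvd hm.two_dvd
    rw [hgcd] at h2
    norm_num at h2
  obtain ⟨σ, h0, h1, h2, h3⟩ :=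
    exists_perm_even_even_odd_odd B (sum_emod_two_of_odd_bmu B bmu hsum hm)
  have h23 : (B (σ 3) : ZMod 4) = B (σ 2) := by
    rw [← Equiv.sum_comp σ B, ← Equiv.sum_comp σ (fun k => B k ^ 2)] at hsum
    simp only [Fin.sum_univ_four] at hsum
    exact (ZMod.intCast_eq_intCast_iff' _ _ 4).mpr
      (odd_bends_congr_mod_four _ _ _ _ _ hsum hm h0 h1 h2 h3).symm
  simp only [hB']
  have e0 := even_bend_pair_mod_four hm h0
  have e1 := even_bend_pair_mod_four hm h1
  obtain ⟨hε, e2⟩ := odd_bend_pair_mod_four hm h2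
  have e3 := (odd_bend_pair_mod_four hm h3).2.trans h23
  refine ⟨B (σ 2), hε, ⟨σ, e0, e1, rfl, e2, h23, e3⟩, ?_⟩
  rw [σ.surjective.forall]
  have ne_of_even {x y : ZMod 4} (h : x = 0 ∧ y = 2 ∨ x = 2 ∧ y = 0) :
      x ≠ -(B (σ 2) : ZMod 4) ∧ y ≠ -(B (σ 2) : ZMod 4) := by
    rcases hε with hε | hε <;> rw [hε] <;> clear * - h <;> decide +revert
  have ne_neg : (B (σ 2) : ZMod 4) ≠ -(B (σ 2) : ZMod 4) := by
    rcases hε with hε | hε <;> rw [hε] <;> decide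
  intro k
  fin_cases k
  · exact ne_of_even e0
  · exact ne_of_even e1
  · exact ⟨ne_neg, e2.trans_ne ne_neg⟩
  · exact ⟨h23.trans_ne ne_neg, e3.trans_ne ne_neg⟩
end

section
/- (Persistence of the local obstruction under the Apollonian group) Let b = (b₁,b₂,b₃,b₄,b_μ) be an integer vector satisfying 2b_μ² − 2b_μ(b₁+b₂+b₃+b₄) + (b₁²+b₂²+b₃²+b₄²) = 0, and let c ∈ ℤ/4ℤ with c = 1 or c = 3. Suppose that none of the eight bends b₁, b₂, b₃, b₄, 2b_μ−b₁, 2b_μ−b₂, 2b_μ−b₃, 2b_μ−b₄ is congruent to c modulo 4. Let 𝒫 be the subgroup of GL(5, ℚ) generated by R₁, R₂, R₃, R₄, let P ∈ 𝒫, let S = P·R_f·P⁻¹, and let b′ = (b₁′,b₂′,b₃′,b₄′,b_μ′) = S·b (viewing b as a column vector; b′ is again an integer vector). Then none of the eight bends b₁′, b₂′, b₃′, b₄′, 2b_μ′−b₁′, 2b_μ′−b₂′, 2b_μ′−b₃′, 2b_μ′−b₄′ is congruent to c modulo 4. -/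
open Matrix

/-- `R₁`: swaps the first and second coordinates. -/
def R1 : Matrix (Fin 5) (Fin 5) ℚ :=
  !![0, 1, 0, 0, 0;
     1, 0, 0, 0, 0;
     0, 0, 1, 0, 0;
     0, 0, 0, 1, 0;
     0, 0, 0, 0, 1]

/-- `R₂`: swaps the second and third coordinates. -/
def R2 : Matrix (Fin 5) (Fin 5) ℚ :=
  !![1, 0, 0, 0, 0;
     0, 0, 1, 0, 0;
     0, 1, 0, 0, 0;
     0, 0, 0, 1, 0;
     0, 0, 0, 0, 1]

/-- `R₃`: swaps the third and fourth coordinates. -/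
def R3 : Matrix (Fin 5) (Fin 5) ℚ :=
  !![1, 0, 0, 0, 0;
     0, 1, 0, 0, 0;
     0, 0, 0, 1, 0;
     0, 0, 1, 0, 0;
     0, 0, 0, 0, 1]

/-- `R₄`: the identity except that the fourth row is `(0,0,0,−1,2)`. -/
def R4 : Matrix (Fin 5) (Fin 5) ℚ :=
  !![1, 0, 0, 0, 0;
     0, 1, 0, 0, 0;
     0, 0, 1, 0, 0;
     0, 0, 0, -1, 2;
     0, 0, 0, 0, 1]

/-- The inversion matrix `R_f`. -/
def Rf : Matrix (Fin 5) (Fin 5) ℚ :=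
  !![1, 0, 0, 0, 0;
     0, 1, 0, 0, 0;
     0, 0, 1, 0, 0;
     0, 0, 0, 1, 0;
     1, 1, 1, 1, -1]

/-- The generators of the orthoplicial Platonic group. -/
def platonicGens : Set (GL (Fin 5) ℚ) :=
  { P | (P : Matrix (Fin 5) (Fin 5) ℚ) = R1 ∨ (P : Matrix (Fin 5) (Fin 5) ℚ) = R2 ∨
        (P : Matrix (Fin 5) (Fin 5) ℚ) = R3 ∨ (P : Matrix (Fin 5) (Fin 5) ℚ) = R4 }

/-- A rational vector is `Unobstructing c` when it is integral, its first four entries have even sum,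
and none of its eight bends is congruent to `c` modulo 4. -/
def Unobstructing (c : ZMod 4) (w : Fin 5 → ℚ) : Prop :=
  ∃ v : Fin 5 → ℤ, (fun i => (v i : ℚ)) = w ∧ Even (v 0 + v 1 + v 2 + v 3) ∧
    ∀ k : Fin 4, ((v k.castSucc : ZMod 4) ≠ c ∧
      ((2 * v 4 - v k.castSucc : ℤ) : ZMod 4) ≠ c)

lemma Unobstructing.R1_mulVec {c : ZMod 4} {w : Fin 5 → ℚ} (h : Unobstructing c w) :
    Unobstructing c (R1 *ᵥ w) := by
  obtain ⟨v, rfl, he, hv⟩ := h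
  refine ⟨![v 1, v 0, v 2, v 3, v 4], ?_, ?_, ?_⟩
  · ext i
    fin_cases i <;> simp [R1, Matrix.mulVec, dotProduct, Fin.sum_univ_five]
  · simpa [add_comm (v 1)] using he
  · have h0 := hv 0
    have h1 := hv 1
    have h2 := hv 2
    have h3 := hv 3
    intro k
    fin_cases k
    exacts [h1, h0, h2, h3]

lemma Unobstructing.R2_mulVec {c : ZMod 4} {w : Fin 5 → ℚ} (h : Unobstructing c w) :
    Unobstructing c (R2 *ᵥ w) := by
  obtain ⟨v, rfl, he, hv⟩ := h
  refine ⟨![v 0, v 2, v 1, v 3, v 4], ?_, ?_, ?_⟩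
  · ext i
    fin_cases i <;> simp [R2, Matrix.mulVec, dotProduct, Fin.sum_univ_five]
  · simpa [add_right_comm (v 0) (v 2)] using he
  · have h0 := hv 0
    have h1 := hv 1
    have h2 := hv 2
    have h3 := hv 3
    intro k
    fin_cases k
    exacts [h0, h2, h1, h3]

lemma Unobstructing.R3_mulVec {c : ZMod 4} {w : Fin 5 → ℚ} (h : Unobstructing c w) :
    Unobstructing c (R3 *ᵥ w) := by
  obtain ⟨v, rfl, he, hv⟩ := h
  refine ⟨![v 0, v 1, v 3, v 2, v 4], ?_, ?_, ?_⟩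
  · ext i
    fin_cases i <;> simp [R3, Matrix.mulVec, dotProduct, Fin.sum_univ_five]
  · simpa [add_right_comm (v 0 + v 1) (v 3)] using he
  · have h0 := hv 0
    have h1 := hv 1
    have h2 := hv 2
    have h3 := hv 3
    intro k
    fin_cases k
    exacts [h0, h1, h3, h2]

lemma Unobstructing.R4_mulVec {c : ZMod 4} {w : Fin 5 → ℚ} (h : Unobstructing c w) :
    Unobstructing c (R4 *ᵥ w) := by
  obtain ⟨v, rfl, he, hv⟩ := h
  refine ⟨![v 0, v 1, v 2, 2 * v 4 - v 3, v 4], ?_, ?_, ?_⟩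
  · ext i
    fin_cases i <;> simp [R4, Matrix.mulVec, dotProduct, Fin.sum_univ_five]
    ring
  · change Even (v 0 + v 1 + v 2 + (2 * v 4 - v 3))
    grind
  · have h0 := hv 0
    have h1 := hv 1
    have h2 := hv 2
    have h3 := hv 3
    intro k
    fin_cases k
    · exact h0
    · exact h1
    · exact h2
    · refine ⟨h3.2, ?_⟩
      change ((2 * v 4 - (2 * v 4 - v 3) : ℤ) : ZMod 4) ≠ c
      rw [sub_sub_cancel]
      exact h3.1

lemma Unobstructing.Rf_mulVec {c : ZMod 4} {w : Fin 5 → ℚ} (h : Unobstructing c w) :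
    Unobstructing c (Rf *ᵥ w) := by
  obtain ⟨v, rfl, he, hv⟩ := h
  refine ⟨![v 0, v 1, v 2, v 3, v 0 + v 1 + v 2 + v 3 - v 4], ?_, he, ?_⟩
  · ext i
    fin_cases i <;> simp [Rf, Matrix.mulVec, dotProduct, Fin.sum_univ_five]
    ring
  · have key (x : ℤ) : ((2 * (v 0 + v 1 + v 2 + v 3 - v 4) - x : ℤ) : ZMod 4) =
        ((2 * v 4 - x : ℤ) : ZMod 4) := by
      obtain ⟨m, hm⟩ := he
      refine (ZMod.intCast_eq_intCast_iff_dvd_sub _ _ 4).2 ⟨v 4 - m, ?_⟩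
      rw [hm]
      push_cast
      ring
    have h0 := hv 0
    have h1 := hv 1
    have h2 := hv 2
    have h3 := hv 3
    intro k
    fin_cases k
    · exact ⟨h0.1, (key (v 0)).trans_ne h0.2⟩
    · exact ⟨h1.1, (key (v 1)).trans_ne h1.2⟩
    · exact ⟨h2.1, (key (v 2)).trans_ne h2.2⟩
    · exact ⟨h3.1, (key (v 3)).trans_ne h3.2⟩

lemma mul_self_eq_one_of_mem_platonicGens {P : GL (Fin 5) ℚ} (hP : P ∈ platonicGens) :
    P * P = 1 := by
  apply Units.ext
  rw [Units.val_mul, Units.val_one]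
  rcases hP with h | h | h | h <;> rw [h] <;> ext i j <;> fin_cases i <;> fin_cases j <;>
    simp [R1, R2, R3, R4, Matrix.mul_apply, Fin.sum_univ_succ]

lemma Unobstructing.mulVec_of_mem_platonicGens {c : ZMod 4} {P : GL (Fin 5) ℚ}
    (hP : P ∈ platonicGens) {w : Fin 5 → ℚ} (h : Unobstructing c w) :
    Unobstructing c (P.val *ᵥ w) := by
  rcases hP with hP | hP | hP | hP <;> rw [hP]
  exacts [h.R1_mulVec, h.R2_mulVec, h.R3_mulVec, h.R4_mulVec]

lemma Unobstructing.mulVec_of_mem_closure {c : ZMod 4} {P : GL (Fin 5) ℚ}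
    (hP : P ∈ Subgroup.closure platonicGens) {w : Fin 5 → ℚ} (h : Unobstructing c w) :
    Unobstructing c (P.val *ᵥ w) := by
  induction hP using Subgroup.closure_induction'' generalizing w with
  | one => simpa using h
  | mem x hx => exact h.mulVec_of_mem_platonicGens hx
  | inv_mem x hx =>
    rw [inv_eq_of_mul_eq_one_left (mul_self_eq_one_of_mem_platonicGens hx)]
    exact h.mulVec_of_mem_platonicGens hx
  | mul x y _ _ hx hy =>
    rw [Units.val_mul, ← Matrix.mulVec_mulVec]
    exact hx (hy h)

/-- Persistence of the local obstruction mod 4 under the generators `P R_f P⁻¹` of the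
orthoplicial Apollonian group. -/
theorem local_obstruction_persists
    (b : Fin 5 → ℤ)
    (hD : 2*(b 4)^2 - 2*(b 4)*(b 0 + b 1 + b 2 + b 3)
        + ((b 0)^2 + (b 1)^2 + (b 2)^2 + (b 3)^2) = 0)
    (c : ZMod 4) (hc : c = 1 ∨ c = 3)
    (hobs : ∀ k : Fin 4, ((b k.castSucc : ZMod 4) ≠ c ∧
      ((2 * b 4 - b k.castSucc : ℤ) : ZMod 4) ≠ c))
    (P : GL (Fin 5) ℚ) (hP : P ∈ Subgroup.closure platonicGens)
    (S : Matrix (Fin 5) (Fin 5) ℚ)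
    (hS : S = (P : Matrix (Fin 5) (Fin 5) ℚ) * Rf *
      ((P⁻¹ : GL (Fin 5) ℚ) : Matrix (Fin 5) (Fin 5) ℚ)) :
    ∃ b' : Fin 5 → ℤ,
      ((fun i => ((b' i : ℚ))) = S *ᵥ (fun i => ((b i : ℚ)))) ∧
      ∀ k : Fin 4, ((b' k.castSucc : ZMod 4) ≠ c ∧
        ((2 * b' 4 - b' k.castSucc : ℤ) : ZMod 4) ≠ c) := by
  have hb : Unobstructing c (fun i => (b i : ℚ)) := by
    refine ⟨b, rfl, ?_, hobs⟩
    have hsq : Even ((b 0) ^ 2 + (b 1) ^ 2 + (b 2) ^ 2 + (b 3) ^ 2) :=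
      ⟨b 4 * (b 0 + b 1 + b 2 + b 3) - (b 4) ^ 2, by linarith⟩
    simpa [Int.even_add, Int.even_pow] using hsq
  obtain ⟨b', hb', -, h⟩ :=
    ((hb.mulVec_of_mem_closure (inv_mem hP)).Rf_mulVec).mulVec_of_mem_closure hP
  refine ⟨b', ?_, h⟩
  rw [hb', hS, Matrix.mulVec_mulVec, Matrix.mulVec_mulVec, mul_assoc]
end

section
/- (Identification of the spin preimage as a congruence subgroup) In SL(2, ℤ[i]), let Λ be the set of matrices [[α,β],[γ,δ]] that are congruent modulo 2 to [[1,0],[0,1]], [[−1,0],[0,−1]], [[i,0],[0,−i]], or [[−i,0],[0,i]]. Then Λ is a subgroup of SL(2, ℤ[i]), and Λ equals the subgroup of SL(2, ℤ[i]) generated by the negative identity matrix −I together with the seven matrices [[i,0],[0,−i]], [[1,0],[2,1]], [[i,0],[2,−i]], [[1+2i,2],[2,1−2i]], [[1,2],[0,1]], [[i,2],[0,−i]], [[2+i,2],[2,2−i]]. -/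
open Matrix

/-- Entrywise congruence modulo 2 of `2 × 2` matrices over the Gaussian integers. -/
def CongMod2 (A B : Matrix (Fin 2) (Fin 2) GaussianInt) : Prop :=
  ∀ i j, (2 : GaussianInt) ∣ (A i j - B i j)

/-- The set `Λ` of elements of `SL(2, ℤ[i])` congruent mod 2 to `±I` or `±iI`. -/
def Lambda : Set (Matrix.SpecialLinearGroup (Fin 2) GaussianInt) :=
  { g | CongMod2 g !![1, 0; 0, 1] ∨ CongMod2 g !![-1, 0; 0, -1] ∨
        CongMod2 g !![⟨0,1⟩, 0; 0, ⟨0,-1⟩] ∨ CongMod2 g !![⟨0,-1⟩, 0; 0, ⟨0,1⟩] }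

/-- `−I` as an element of `SL(2, ℤ[i])`. -/
def gNegOne : Matrix.SpecialLinearGroup (Fin 2) GaussianInt :=
  ⟨!![-1, 0; 0, -1], by rw [Matrix.det_fin_two_of]; decide⟩

/-- `[[i,0],[0,−i]]`. -/
def gS238 : Matrix.SpecialLinearGroup (Fin 2) GaussianInt :=
  ⟨!![⟨0,1⟩, 0; 0, ⟨0,-1⟩], by rw [Matrix.det_fin_two_of]; decide⟩

/-- `[[1,0],[2,1]]`. -/
def gS278 : Matrix.SpecialLinearGroup (Fin 2) GaussianInt :=
  ⟨!![1, 0; 2, 1], by rw [Matrix.det_fin_two_of]; decide⟩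

/-- `[[i,0],[2,−i]]`. -/
def gS274 : Matrix.SpecialLinearGroup (Fin 2) GaussianInt :=
  ⟨!![⟨0,1⟩, 0; 2, ⟨0,-1⟩], by rw [Matrix.det_fin_two_of]; decide⟩

/-- `[[1+2i,2],[2,1−2i]]`. -/
def gS674 : Matrix.SpecialLinearGroup (Fin 2) GaussianInt :=
  ⟨!![⟨1,2⟩, 2; 2, ⟨1,-2⟩], by rw [Matrix.det_fin_two_of]; decide⟩

/-- `[[1,2],[0,1]]`. -/
def gS638 : Matrix.SpecialLinearGroup (Fin 2) GaussianInt :=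
  ⟨!![1, 2; 0, 1], by rw [Matrix.det_fin_two_of]; decide⟩

/-- `[[i,2],[0,−i]]`. -/
def gS634 : Matrix.SpecialLinearGroup (Fin 2) GaussianInt :=
  ⟨!![⟨0,1⟩, 2; 0, ⟨0,-1⟩], by rw [Matrix.det_fin_two_of]; decide⟩

/-- `[[2+i,2],[2,2−i]]`. -/
def gS678 : Matrix.SpecialLinearGroup (Fin 2) GaussianInt :=
  ⟨!![⟨2,1⟩, 2; 2, ⟨2,-1⟩], by rw [Matrix.det_fin_two_of]; decide⟩

theorem GaussianInt.two_dvd_iff (z : GaussianInt) :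
    (2 : GaussianInt) ∣ z ↔ (2 : ℤ) ∣ z.re ∧ (2 : ℤ) ∣ z.im := by
  simpa using Zsqrtd.intCast_dvd (d := -1) 2 z

theorem sl2_det_eq_one (g : Matrix.SpecialLinearGroup (Fin 2) GaussianInt) :
    g 0 0 * g 1 1 - g 0 1 * g 1 0 = 1 := by
  rw [← Matrix.det_fin_two, g.det_coe]

theorem odd_re_add_im_of_two_dvd (g : Matrix.SpecialLinearGroup (Fin 2) GaussianInt)
    (hc : (2 : GaussianInt) ∣ g 1 0) :
    ((g 0 0).re + (g 0 0).im) % 2 = 1 := by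
  obtain ⟨k, hk⟩ := hc
  have h := sl2_det_eq_one g
  rw [hk] at h
  have hre := congrArg Zsqrtd.re h
  have him := congrArg Zsqrtd.im h
  simp at hre him
  rcases Int.emod_two_eq_zero_or_one ((g 0 0).re + (g 0 0).im) with h0 | h0
  · exfalso
    obtain ⟨t, ht⟩ := Int.dvd_of_emod_eq_zero h0
    obtain ⟨x, hx⟩ : ∃ x, x = (g 0 0).re := ⟨_, rfl⟩
    obtain ⟨y, hy⟩ : ∃ y, y = (g 0 0).im := ⟨_, rfl⟩
    rw [← hx] at hre him ht
    rw [← hy] at hre him ht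
    obtain rfl : x = 2 * t - y := by omega
    have : 2 * (t * ((g 1 1).re + (g 1 1).im) - y * (g 1 1).im
        - ((g 0 1).re * k.re - (g 0 1).im * k.im)
        - ((g 0 1).re * k.im + (g 0 1).im * k.re)) = 1 := by
      linear_combination hre + him
    omega
  · exact h0

/-- Membership in `Λ` amounts to both off-diagonal entries being even. -/
theorem mem_Lambda_iff (g : Matrix.SpecialLinearGroup (Fin 2) GaussianInt) :
    g ∈ Lambda ↔ (2 : GaussianInt) ∣ g 0 1 ∧ (2 : GaussianInt) ∣ g 1 0 := by
  constructor
  · rintro (h | h | h | h) <;> exact ⟨by simpa using h 0 1, by simpa using h 1 0⟩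
  · rintro ⟨hb, hc⟩
    have ha := odd_re_add_im_of_two_dvd g hc
    have h := sl2_det_eq_one g
    obtain ⟨k, hk⟩ := id hc
    rw [hk] at h
    have hre := congrArg Zsqrtd.re h
    have him := congrArg Zsqrtd.im h
    simp at hre him
    have key : ((g 0 0).re % 2 = 1 ∧ (g 0 0).im % 2 = 0 ∧ (g 1 1).re % 2 = 1 ∧ (g 1 1).im % 2 = 0)
        ∨ ((g 0 0).re % 2 = 0 ∧ (g 0 0).im % 2 = 1 ∧ (g 1 1).re % 2 = 0 ∧ (g 1 1).im % 2 = 1) := by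
      generalize (g 0 0).re = x at *
      generalize (g 0 0).im = y at *
      generalize (g 1 1).re = z at *
      generalize (g 1 1).im = w at *
      have h1 : (x * z - y * w) % 2 = 1 := by
        have : x * z - y * w = 1 + 2 * ((g 0 1).re * k.re - (g 0 1).im * k.im) := by
          linear_combination hre
        omega
      have h2 : (x * w + y * z) % 2 = 0 := by
        have : x * w + y * z = 2 * ((g 0 1).re * k.im + (g 0 1).im * k.re) := by
          linear_combination him
        omega
      rcases Int.emod_two_eq_zero_or_one x with hx | hx <;>
      rcases Int.emod_two_eq_zero_or_one y with hy | hy <;>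
      rcases Int.emod_two_eq_zero_or_one z with hz | hz <;>
      rcases Int.emod_two_eq_zero_or_one w with hw | hw <;>
      simp [Int.sub_emod, Int.add_emod, Int.mul_emod, hx, hy, hz, hw] at h1 h2 ha ⊢
    rcases key with ⟨h1, h2, h3, h4⟩ | ⟨h1, h2, h3, h4⟩
    · left
      intro i j
      fin_cases i <;> fin_cases j <;>
        first | simpa using hb | simpa using hc | (simp [GaussianInt.two_dvd_iff]; omega)
    · right; right; left
      intro i j
      fin_cases i <;> fin_cases j <;>
        first | simpa using hb | simpa using hc | (simp [GaussianInt.two_dvd_iff]; omega)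

/-- `Λ` as a subgroup of `SL(2, ℤ[i])`. -/
def LambdaSubgroup : Subgroup (Matrix.SpecialLinearGroup (Fin 2) GaussianInt) where
  carrier := Lambda
  one_mem' := by simp [mem_Lambda_iff]
  mul_mem' {g h} hg hh := by
    rw [mem_Lambda_iff] at *
    simp only [Matrix.SpecialLinearGroup.coe_mul, Matrix.mul_apply, Fin.sum_univ_two]
    exact ⟨dvd_add (hh.1.mul_left _) (hg.1.mul_right _),
      dvd_add (hg.2.mul_right _) (hh.2.mul_left _)⟩
  inv_mem' {g} hg := by
    rw [mem_Lambda_iff] at *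
    simpa [Matrix.SpecialLinearGroup.coe_inv, Matrix.adjugate_fin_two] using hg

/-- The subgroup generated by `−I` and the seven spin lifts. -/
def spinSubgroup : Subgroup (Matrix.SpecialLinearGroup (Fin 2) GaussianInt) :=
  Subgroup.closure {gNegOne, gS238, gS278, gS274, gS674, gS638, gS634, gS678}

theorem spinSubgroup_le_LambdaSubgroup : spinSubgroup ≤ LambdaSubgroup := by
  refine (Subgroup.closure_le _).2 ?_
  rintro g (rfl | rfl | rfl | rfl | rfl | rfl | rfl | rfl) <;>
  · change _ ∈ Lambda
    rw [mem_Lambda_iff]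
    constructor <;> simp [gNegOne, gS238, gS278, gS274, gS674, gS638, gS634, gS678]

theorem coe_gS238 : (gS238 : Matrix (Fin 2) (Fin 2) GaussianInt) = !![⟨0, 1⟩, 0; 0, ⟨0, -1⟩] := rfl

theorem gS238_mem : gS238 ∈ spinSubgroup := Subgroup.subset_closure (by simp)

/-- The upper unipotent matrix `[[1,x],[0,1]]`. -/
def upperUnipotent (x : GaussianInt) : Matrix.SpecialLinearGroup (Fin 2) GaussianInt :=
  ⟨!![1, x; 0, 1], by simp [Matrix.det_fin_two_of]⟩

theorem coe_upperUnipotent (x : GaussianInt) :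
    (upperUnipotent x : Matrix (Fin 2) (Fin 2) GaussianInt) = !![1, x; 0, 1] := rfl

theorem upperUnipotent_add (x y : GaussianInt) :
    upperUnipotent (x + y) = upperUnipotent x * upperUnipotent y := by
  ext i j : 1
  fin_cases i <;> fin_cases j <;> simp [coe_upperUnipotent, add_comm]

theorem upperUnipotent_zsmul (n : ℤ) (x : GaussianInt) :
    upperUnipotent (n • x) = upperUnipotent x ^ n :=
  map_zsmul (AddMonoidHom.mk' (fun x => Additive.ofMul (upperUnipotent x)) upperUnipotent_add) n x

theorem upperUnipotent_mem (x : GaussianInt) : upperUnipotent (2 * x) ∈ spinSubgroup := by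
  have h1 : upperUnipotent 2 ∈ spinSubgroup := 
    Subgroup.subset_closure (by simp [show upperUnipotent 2 = gS638 from rfl])
  have h2 : upperUnipotent ⟨0, -2⟩ ∈ spinSubgroup := by
    have h : upperUnipotent ⟨0, -2⟩ = gS238⁻¹ * gS634 := by
      ext i j : 1
      fin_cases i <;> fin_cases j <;>
        simp [coe_upperUnipotent, coe_gS238,
          show (gS634 : Matrix (Fin 2) (Fin 2) GaussianInt) = !![⟨0, 1⟩, 2; 0, ⟨0, -1⟩] from rfl,
          Matrix.adjugate_fin_two, Zsqrtd.ext_iff]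
    rw [h]
    exact mul_mem (inv_mem gS238_mem) (Subgroup.subset_closure (by simp))
  have h : 2 * x = x.re • (2 : GaussianInt) + (-x.im) • (⟨0, -2⟩ : GaussianInt) := by
    simp [Zsqrtd.ext_iff, mul_comm]
  rw [h, upperUnipotent_add, upperUnipotent_zsmul, upperUnipotent_zsmul]
  exact mul_mem (zpow_mem h1 _) (zpow_mem h2 _)

/-- Some element of the spin subgroup has a bottom row proportional, by a unit, to `(-2, p)`. -/
def HasBottomRow (p : GaussianInt) : Prop :=
  ∃ h ∈ spinSubgroup, ∃ e : GaussianInt, e.norm = 1 ∧ h 1 0 = -2 * e ∧ h 1 1 = p * e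

theorem HasBottomRow.neg {p : GaussianInt} (hp : HasBottomRow p) : HasBottomRow (-p) := by
  obtain ⟨h, hh, e, he, h0, h1⟩ := hp
  refine ⟨h * gS238, mul_mem hh gS238_mem, e * ⟨0, 1⟩, ?_, ?_, ?_⟩
  · rw [Zsqrtd.norm_mul, he]; simp [Zsqrtd.norm_def]
  · simp [Matrix.mul_apply, coe_gS238, h0, mul_assoc]
  · have : (⟨0, -1⟩ : GaussianInt) = -⟨0, 1⟩ := by simp [Zsqrtd.ext_iff]
    simp [Matrix.mul_apply, coe_gS238, h1, mul_assoc, this]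

theorem HasBottomRow.add_four_mul {p : GaussianInt} (hp : HasBottomRow p) (x : GaussianInt) :
    HasBottomRow (p + 4 * x) := by
  obtain ⟨h, hh, e, he, h0, h1⟩ := hp
  refine ⟨h * upperUnipotent (2 * -x), mul_mem hh (upperUnipotent_mem _), e, he, ?_, ?_⟩
  · simp [Matrix.mul_apply, coe_upperUnipotent, h0]
  · simp [Matrix.mul_apply, coe_upperUnipotent, h0, h1]
    ring

theorem hasBottomRow_inv {g : Matrix.SpecialLinearGroup (Fin 2) GaussianInt}
    (hg : g ∈ spinSubgroup) (h : g 1 0 = 2) :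
    HasBottomRow (g 0 0) :=
  ⟨g⁻¹, inv_mem hg, 1, by simp, by simp [Matrix.adjugate_fin_two, h],
    by simp [Matrix.adjugate_fin_two]⟩

theorem hasBottomRow_of_odd (p : GaussianInt) (hp : (p.re + p.im) % 2 = 1) : HasBottomRow p := by
  have h1 : HasBottomRow ⟨1, 0⟩ :=
    hasBottomRow_inv (g := gS278) (Subgroup.subset_closure (by simp)) (by simp [gS278])
  have h2 : HasBottomRow ⟨0, 1⟩ :=
    hasBottomRow_inv (g := gS274) (Subgroup.subset_closure (by simp)) (by simp [gS274])
  have h3 : HasBottomRow ⟨1, 2⟩ :=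
    hasBottomRow_inv (g := gS674) (Subgroup.subset_closure (by simp)) (by simp [gS674])
  have h4 : HasBottomRow ⟨2, 1⟩ :=
    hasBottomRow_inv (g := gS678) (Subgroup.subset_closure (by simp)) (by simp [gS678])
  have key : ∀ q : GaussianInt, HasBottomRow q → (p.re - q.re) % 4 = 0 → (p.im - q.im) % 4 = 0 →
      HasBottomRow p := by
    intro q hq hre him
    have : p = q + 4 * ⟨(p.re - q.re) / 4, (p.im - q.im) / 4⟩ := by
      rw [Zsqrtd.ext_iff]
      simp
      omega
    rw [this]
    exact hq.add_four_mul _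
  have : (p.re % 4 = 1 ∧ p.im % 4 = 0) ∨ (p.re % 4 = 3 ∧ p.im % 4 = 0) ∨
      (p.re % 4 = 0 ∧ p.im % 4 = 1) ∨ (p.re % 4 = 0 ∧ p.im % 4 = 3) ∨
      (p.re % 4 = 1 ∧ p.im % 4 = 2) ∨ (p.re % 4 = 3 ∧ p.im % 4 = 2) ∨
      (p.re % 4 = 2 ∧ p.im % 4 = 1) ∨ (p.re % 4 = 2 ∧ p.im % 4 = 3) := by omega
  rcases this with h | h | h | h | h | h | h | h
  · exact key _ h1 (by simp; omega) (by simp; omega)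
  · exact key _ h1.neg (by simp; omega) (by simp; omega)
  · exact key _ h2 (by simp; omega) (by simp; omega)
  · exact key _ h2.neg (by simp; omega) (by simp; omega)
  · exact key _ h3 (by simp; omega) (by simp; omega)
  · exact key _ h3.neg (by simp; omega) (by simp; omega)
  · exact key _ h4 (by simp; omega) (by simp; omega)
  · exact key _ h4.neg (by simp; omega) (by simp; omega)

theorem exists_centered_remainder (u n : ℤ) (hn : 0 < n) : ∃ q, 2 * |u - n * q| ≤ n := by
  by_cases h : 2 * (u % n) ≤ n
  · refine ⟨u / n, ?_⟩
    have := Int.emod_add_mul_ediv u n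
    have h0 := Int.emod_nonneg u hn.ne'
    rw [show u - n * (u / n) = u % n by linarith, abs_of_nonneg h0]
    exact h
  · refine ⟨u / n + 1, ?_⟩
    have := Int.emod_add_mul_ediv u n
    have h0 := Int.emod_lt_of_pos u hn
    rw [show u - n * (u / n + 1) = u % n - n by linarith, abs_of_neg (by linarith)]
    linarith

theorem exists_sq_add_sq_lt_of_abs_le {n r s : ℤ} (hr : 2 * |r| ≤ n)
    (hrs : |s| ≤ |r|) (h0 : r ≠ 0) : ∃ e : ℤ, |e| = 1 ∧ (r - n * e) ^ 2 + s ^ 2 < n ^ 2 := by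
  have hs : s ^ 2 ≤ r ^ 2 := sq_le_sq.2 hrs
  rcases lt_or_gt_of_ne h0 with h | h
  · rw [abs_of_neg h] at hr
    exact ⟨-1, by simp, by nlinarith⟩
  · rw [abs_of_pos h] at hr
    exact ⟨1, by simp, by nlinarith⟩

/-- Away from the multiples of `n` of even Gaussian integers,
every Gaussian integer is at distance less than `n` from `n` times an odd one. -/
theorem exists_odd_sq_add_sq_lt (u v n : ℤ) (hn : 0 < n)
    (h : ∀ p q : ℤ, u = n * p → v = n * q → (p + q) % 2 = 1) :
    ∃ p q : ℤ, (p + q) % 2 = 1 ∧ (u - n * p) ^ 2 + (v - n * q) ^ 2 < n ^ 2 := by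
  obtain ⟨p, hp⟩ := exists_centered_remainder u n hn
  obtain ⟨q, hq⟩ := exists_centered_remainder v n hn
  by_cases hpq : (p + q) % 2 = 1
  · refine ⟨p, q, hpq, ?_⟩
    rw [← sq_abs (u - n * p), ← sq_abs (v - n * q)]
    nlinarith [abs_nonneg (u - n * p), abs_nonneg (v - n * q)]
  have hodd : ∀ e : ℤ, |e| = 1 → (p + e + q) % 2 = 1 := by
    intro e he
    rcases (abs_eq zero_le_one).1 he with rfl | rfl <;> omega
  have hne : u - n * p ≠ 0 ∨ v - n * q ≠ 0 := by
    by_contra! hcon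
    exact hpq (h p q (by linarith) (by linarith))
  rcases le_total |v - n * q| |u - n * p| with hle | hle
  · have h0 : u - n * p ≠ 0 := by
      intro h0
      rw [h0, abs_zero, abs_nonpos_iff] at hle
      simp_all
    obtain ⟨e, he, hlt⟩ := exists_sq_add_sq_lt_of_abs_le hp hle h0
    refine ⟨p + e, q, hodd e he, ?_⟩
    rw [show u - n * (p + e) = u - n * p - n * e by ring]
    exact hlt
  · have h0 : v - n * q ≠ 0 := by
      intro h0
      rw [h0, abs_zero, abs_nonpos_iff] at hle
      simp_all
    obtain ⟨e, he, hlt⟩ := exists_sq_add_sq_lt_of_abs_le hq hle h0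
    refine ⟨p, q + e, by have := hodd e he; omega, ?_⟩
    rw [show v - n * (q + e) = v - n * q - n * e by ring]
    linarith

/-- Division with odd quotient and strictly smaller remainder. -/
theorem exists_odd_quotient (a c : GaussianInt) (ha : (a.re + a.im) % 2 = 1) (hc : c ≠ 0) :
    ∃ p : GaussianInt, (p.re + p.im) % 2 = 1 ∧ (a - p * c).norm < c.norm := by
  have hn : 0 < c.norm := GaussianInt.norm_pos.2 hc
  have hstar : c * star c = c.norm := (Zsqrtd.norm_eq_mul_conj c).symm
  have hre : ∀ p q : ℤ, ((a - ⟨p, q⟩ * c) * star c) =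
      ⟨(a * star c).re - c.norm * p, (a * star c).im - c.norm * q⟩ := by
    intro p q
    rw [sub_mul, mul_assoc, hstar]
    simp [Zsqrtd.ext_iff, mul_comm]
  obtain ⟨p, q, hpq, hlt⟩ := exists_odd_sq_add_sq_lt (a * star c).re (a * star c).im c.norm hn (by
    intro p q hp hq
    have h0 : (a - ⟨p, q⟩ * c) * star c = 0 := by
      rw [hre, hp, hq]; simp [Zsqrtd.ext_iff]
    have h1 : a = ⟨p, q⟩ * c := by
      rcases mul_eq_zero.1 h0 with h | h
      · exact sub_eq_zero.1 h
      · exact absurd (star_eq_zero.1 h) hc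
    rw [h1] at ha
    simp at ha
    by_contra hcon
    have h2 : ∃ t, p = 2 * t - q := ⟨(p + q) / 2, by omega⟩
    obtain ⟨t, rfl⟩ := h2
    have : (2 * t - q) * c.re + -(q * c.im) + ((2 * t - q) * c.im + q * c.re)
      = 2 * (t * c.re + t * c.im - q * c.im) := by ring
    omega)
  refine ⟨⟨p, q⟩, hpq, ?_⟩
  have h := congrArg Zsqrtd.norm (hre p q)
  rw [Zsqrtd.norm_mul, Zsqrtd.norm_conj] at h
  rw [Zsqrtd.norm_def ⟨(a * star c).re - _, _⟩] at h
  refine lt_of_mul_lt_mul_right ?_ hn.le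
  rw [h]
  linarith

theorem mem_spinSubgroup_of_lower_left_eq_zero (g : Matrix.SpecialLinearGroup (Fin 2) GaussianInt)
    (hg : g ∈ Lambda) (h0 : g 1 0 = 0) :
    g ∈ spinSubgroup := by
  have hdet := sl2_det_eq_one g
  rw [h0, mul_zero, sub_zero] at hdet
  obtain ⟨b, hb⟩ := ((mem_Lambda_iff g).1 hg).1
  have hnorm : (g 0 0).norm = 1 := by
    rw [Zsqrtd.norm_eq_one_iff' (by norm_num)]
    exact IsUnit.of_mul_eq_one _ hdet
  obtain ⟨n, hn⟩ : ∃ n : ℕ, gS238 ^ n ∈ spinSubgroup ∧ (gS238 ^ n) 0 0 = g 0 0 ∧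
      (gS238 ^ n) 0 1 = 0 ∧ (gS238 ^ n) 1 0 = 0 := by
    have hcase : (g 0 0 = 1 ∨ g 0 0 = -1) ∨ g 0 0 = ⟨0, 1⟩ ∨ g 0 0 = ⟨0, -1⟩ := by
      rw [Zsqrtd.norm_def] at hnorm
      have h1 : (g 0 0).re ≤ 1 := by nlinarith [sq_nonneg (g 0 0).im]
      have h2 : -1 ≤ (g 0 0).re := by nlinarith [sq_nonneg (g 0 0).im]
      have h3 : (g 0 0).im ≤ 1 := by nlinarith [sq_nonneg (g 0 0).re]
      have h4 : -1 ≤ (g 0 0).im := by nlinarith [sq_nonneg (g 0 0).re]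
      simp only [Zsqrtd.ext_iff]
      generalize (g 0 0).re = x at *
      generalize (g 0 0).im = y at *
      interval_cases x <;> interval_cases y <;> simp at hnorm ⊢
    rcases hcase with (h | h) | h | h
    · exact ⟨0, pow_mem gS238_mem _, by simp [h]⟩
    · exact ⟨2, pow_mem gS238_mem _, by simp [h, pow_succ, coe_gS238, Zsqrtd.ext_iff]⟩
    · exact ⟨1, pow_mem gS238_mem _, by simp [h, coe_gS238]⟩
    · exact ⟨3, pow_mem gS238_mem _, by simp [h, pow_succ, coe_gS238, Zsqrtd.ext_iff]⟩
  generalize gS238 ^ n = h at hn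
  obtain ⟨hh, h00, h01, h10⟩ := hn
  have hdet' := sl2_det_eq_one h
  rw [h10, mul_zero, sub_zero, h00] at hdet'
  have h11 : h 1 1 = g 1 1 := by
    linear_combination g 1 1 * hdet' - h 1 1 * hdet
  have hg : g = h * upperUnipotent (2 * (h 1 1 * b)) := by
    ext i j : 1
    fin_cases i <;> fin_cases j <;>
      simp [Matrix.mul_apply, coe_upperUnipotent, h00, h01, h10, h0, h11, hb]
    linear_combination (-2 * b) * hdet
  rw [hg]
  exact mul_mem hh (upperUnipotent_mem _)

theorem mem_spinSubgroup_of_mem_Lambda (g : Matrix.SpecialLinearGroup (Fin 2) GaussianInt)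
    (hg : g ∈ Lambda) : g ∈ spinSubgroup := by
  induction hk : (g 1 0).norm.natAbs using Nat.strong_induction_on generalizing g with
  | _ k ih =>
    by_cases h0 : g 1 0 = 0
    · exact mem_spinSubgroup_of_lower_left_eq_zero g hg h0
    have hc := ((mem_Lambda_iff g).1 hg).2
    have ha := odd_re_add_im_of_two_dvd g hc
    obtain ⟨c, hc⟩ := hc
    have hc0 : c ≠ 0 := by rintro rfl; simp [hc] at h0
    obtain ⟨p, hp, hlt⟩ := exists_odd_quotient _ c ha hc0
    obtain ⟨h, hh, e, he, h10, h11⟩ := hasBottomRow_of_odd p hp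
    have hhg : (h * g) 1 0 = -2 * e * (g 0 0 - p * c) := by
      simp only [Matrix.SpecialLinearGroup.coe_mul, Matrix.mul_apply, Fin.sum_univ_two, h10, h11, hc]
      ring
    refine (Subgroup.mul_mem_cancel_left _ hh).1 (ih _ ?_ (h * g)
      (LambdaSubgroup.mul_mem (spinSubgroup_le_LambdaSubgroup hh) hg) rfl)
    have h2 : (2 : GaussianInt).norm = 4 := rfl
    rw [← hk, hhg, hc, Zsqrtd.norm_mul, Zsqrtd.norm_mul, Zsqrtd.norm_neg, Zsqrtd.norm_mul, he, h2]
    have := GaussianInt.norm_nonneg (g 0 0 - p * c)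
    omega

/-- Identification of the spin preimage as a congruence subgroup: `Λ` is exactly the subgroup
of `SL(2, ℤ[i])` generated by `−I` and the seven spin lifts of the stabilizer generators. -/
theorem spin_preimage_is_congruence_subgroup :
    Lambda = (Subgroup.closure
      ({gNegOne, gS238, gS278, gS274, gS674, gS638, gS634, gS678} :
        Set (Matrix.SpecialLinearGroup (Fin 2) GaussianInt)) :
      Subgroup (Matrix.SpecialLinearGroup (Fin 2) GaussianInt)) := by
  exact Set.Subset.antisymm mem_spinSubgroup_of_mem_Lambda spinSubgroup_le_LambdaSubgroup
end

section
/- (Positive definiteness of the associated quaternary form) Let b = (b₁,b₂,b₃,b₄,b_μ) ∈ ℝ⁵ satisfy 2b_μ² − 2b_μ(b₁+b₂+b₃+b₄) + (b₁²+b₂²+b₃²+b₄²) = 0 and 2b₁ + b₂ + b₃ ≥ 0. Set A = b₁+b₂, B = −(b₁+b₂+b₃+b₄−2b_μ)/2, C = −(b₁+b₂+b₃−b₄)/2, D = b₁+b₃, and let Q_b be the symmetric 4×4 real matrix with rows (A,0,B,−C), (0,A,C,B), (B,C,D,0), (−C,B,0,D). Then Q_b is positive semidefinite, det Q_b = b₁⁴,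 and Q_b is positive definite if and only if b₁ ≠ 0. -/
open Matrix

noncomputable section

/-- The real symmetric matrix of the binary hermitian form with matrix
`[[A, B + iC], [B - iC, D]]`. -/
def hermitianRealMatrix (A B C D : ℝ) : Matrix (Fin 4) (Fin 4) ℝ :=
  !![A, 0, B, -C;
     0, A, C, B;
     B, C, D, 0;
     -C, B, 0, D]

namespace hermitianRealMatrix

variable (A B C D : ℝ)

theorem isHermitian : (hermitianRealMatrix A B C D).IsHermitian := by
  ext i j
  fin_cases i <;> fin_cases j <;> simp [hermitianRealMatrix]

theorem det_eq : (hermitianRealMatrix A B C D).det = (A * D - B ^ 2 - C ^ 2) ^ 2 := by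
  simp [hermitianRealMatrix, det_succ_row_zero, Fin.sum_univ_succ, Fin.succAbove]
  ring

theorem dotProduct_mulVec (x : Fin 4 → ℝ) :
    x ⬝ᵥ (hermitianRealMatrix A B C D *ᵥ x) =
      A * (x 0 ^ 2 + x 1 ^ 2) + 2 * B * (x 0 * x 2 + x 1 * x 3)
        + 2 * C * (x 1 * x 2 - x 0 * x 3) + D * (x 2 ^ 2 + x 3 ^ 2) := by
  simp [hermitianRealMatrix, dotProduct, mulVec, Fin.sum_univ_succ]
  ring

theorem trace_mul_dotProduct_mulVec (x : Fin 4 → ℝ) :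
    (A + D) * (x ⬝ᵥ (hermitianRealMatrix A B C D *ᵥ x)) =
      (A * x 0 + B * x 2 - C * x 3) ^ 2 + (A * x 1 + C * x 2 + B * x 3) ^ 2
        + (D * x 2 + B * x 0 + C * x 1) ^ 2 + (D * x 3 + B * x 1 - C * x 0) ^ 2
        + (A * D - B ^ 2 - C ^ 2) * (x 0 ^ 2 + x 1 ^ 2 + x 2 ^ 2 + x 3 ^ 2) := by
  rw [dotProduct_mulVec]
  ring

variable {A B C D}

theorem posDef (htr : 0 ≤ A + D) (hdet : 0 < A * D - B ^ 2 - C ^ 2) :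
    (hermitianRealMatrix A B C D).PosDef := by
  have htr' : 0 < A + D := by
    refine htr.lt_of_ne fun h => ?_
    obtain rfl : D = -A := by linarith
    nlinarith [sq_nonneg A, sq_nonneg B, sq_nonneg C]
  refine .of_dotProduct_mulVec_pos (isHermitian A B C D) fun x hx => ?_
  rw [star_trivial]
  refine pos_of_mul_pos_right ?_ htr'.le
  rw [trace_mul_dotProduct_mulVec]
  have hx' : 0 < x 0 ^ 2 + x 1 ^ 2 + x 2 ^ 2 + x 3 ^ 2 := by
    obtain ⟨i, hi⟩ := Function.ne_iff.mp hx
    have hi' : 0 < x i ^ 2 := sq_pos_of_ne_zero hi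
    fin_cases i <;> simp only [Fin.reduceFinMk, Fin.zero_eta, Fin.mk_one] at hi' <;> positivity
  positivity

theorem posSemidef (htr : 0 ≤ A + D) (hdet : 0 ≤ A * D - B ^ 2 - C ^ 2) :
    (hermitianRealMatrix A B C D).PosSemidef := by
  refine .of_dotProduct_mulVec_nonneg (isHermitian A B C D) fun x => ?_
  rw [star_trivial]
  rcases htr.eq_or_lt with h | h
  · obtain rfl : D = -A := by linarith
    have hA : A = 0 := by nlinarith [sq_nonneg A, sq_nonneg B, sq_nonneg C]
    have hB : B = 0 := by nlinarith [sq_nonneg A, sq_nonneg B, sq_nonneg C]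
    have hC : C = 0 := by nlinarith [sq_nonneg A, sq_nonneg B, sq_nonneg C]
    simp [dotProduct_mulVec, hA, hB, hC]
  · refine nonneg_of_mul_nonneg_right ?_ h
    rw [trace_mul_dotProduct_mulVec]
    positivity

end hermitianRealMatrix

/-- Positive definiteness of the quaternary form associated to a bend vector: if
`(b₁,b₂,b₃,b₄,b_μ)` satisfies the orthoplicial Descartes equation and `2b₁+b₂+b₃ ≥ 0`,
then the matrix `Q_b` is positive semidefinite with determinant `b₁⁴`, and it is positive
definite iff `b₁ ≠ 0`. -/
theorem quaternary_form_positive_definite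
    (b1 b2 b3 b4 bmu : ℝ)
    (hD : 2*bmu^2 - 2*bmu*(b1 + b2 + b3 + b4) + (b1^2 + b2^2 + b3^2 + b4^2) = 0)
    (hpos : 0 ≤ 2*b1 + b2 + b3)
    (A B C D : ℝ)
    (hA : A = b1 + b2) (hB : B = -(b1 + b2 + b3 + b4 - 2*bmu)/2)
    (hC : C = -(b1 + b2 + b3 - b4)/2) (hD' : D = b1 + b3)
    (Qb : Matrix (Fin 4) (Fin 4) ℝ)
    (hQb : Qb = !![A, 0, B, -C;
                   0, A, C, B;
                   B, C, D, 0;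
                   -C, B, 0, D]) :
    Qb.PosSemidef ∧ Qb.det = b1^4 ∧ (Qb.PosDef ↔ b1 ≠ 0) := by
  have hdisc : A * D - B ^ 2 - C ^ 2 = b1 ^ 2 := by
    subst hA hB hC hD'
    linear_combination (-1 / 2) * hD
  have htr : 0 ≤ A + D := by linarith
  change Qb = hermitianRealMatrix A B C D at hQb
  subst hQb
  have hdet : (hermitianRealMatrix A B C D).det = b1 ^ 4 := by
    rw [hermitianRealMatrix.det_eq, hdisc]
    ring
  refine ⟨hermitianRealMatrix.posSemidef htr (hdisc ▸ sq_nonneg b1), hdet, ?_, fun hb => ?_⟩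
  · rintro h rfl
    simpa [hdet] using h.det_pos
  · exact hermitianRealMatrix.posDef htr (hdisc ▸ sq_pos_of_ne_zero hb)

end
end
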